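/- Let Σ be the renewal shift and let μ be a σ-invariant Borel probability measure on Σ with μ([a]) = 0 for every symbol a ≥ 2. Then μ is the Dirac measure δ_{1̄} concentrated at the fixed point 1̄ = (1, 1, 1, …); in particular, μ([w]) = δ_{1̄}([w]) for every cylinder [w]. -/

import Mathlib

open MeasureTheory Filter Topology BoundedContinuousFunction
open scoped ENNReal NNReal

noncomputable section

/-! ## Countable Markov shifts (one-sided) -/

/-- The one-sided countable Markov shift over the alphabet `ℕ` determined by the
transition matrix (relation) `A`. -/
structure MShift (A : ℕ → ℕ → Prop) : Type where
  seq : ℕ → ℕ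
  adm : ∀ i : ℕ, A (seq i) (seq (i + 1))

/-- The topology generated by the cylinders: the topology induced from the product
topology on `ℕ → ℕ` (with `ℕ` discrete). -/
instance (A : ℕ → ℕ → Prop) : TopologicalSpace (MShift A) :=
  TopologicalSpace.induced MShift.seq inferInstance

/-- The Borel σ-algebra on the shift space. -/
instance (A : ℕ → ℕ → Prop) : MeasurableSpace (MShift A) := borel (MShift A)

instance (A : ℕ → ℕ → Prop) : BorelSpace (MShift A) := ⟨rfl⟩

/-- The shift map `σ`. -/
def shiftMap (A : ℕ → ℕ → Prop) (x : MShift A) : MShift A :=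
  ⟨fun i => x.seq (i + 1), fun i => x.adm (i + 1)⟩

/-- No row and no column of the transition matrix is identically zero. -/
def NoZeroRC (A : ℕ → ℕ → Prop) : Prop :=
  ∀ i : ℕ, (∃ j, A i j) ∧ (∃ j, A j i)

/-- The cylinder `[x₀ … x_{n-1}]` determined by a finite word `w`. -/
def cylSet (A : ℕ → ℕ → Prop) (w : List ℕ) : Set (MShift A) :=
  {x | ∀ i < w.length, x.seq i = w.getD i 0}

/-- A path: an admissible word `x₀ … xₙ` with `n ≥ 1` and nonempty cylinder. -/
def IsPath (A : ℕ → ℕ → Prop) (w : List ℕ) : Prop :=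
  2 ≤ w.length ∧ w.Chain' A ∧ (cylSet A w).Nonempty

/-- The length `l(γ) = n` of a path `γ = x₀ … xₙ` (represented as a list of `n+1` symbols). -/
def pathLen (w : List ℕ) : ℕ := w.length - 1

/-- The weight `φ(γ) = Σ_{k=0}^{n-1} ψ(x_k x_{k+1})` of a word under a Markov
potential determined by `ψ : ℕ → ℕ → ℝ`. -/
def pathWt (ψ : ℕ → ℕ → ℝ) : List ℕ → ℝ
  | [] => 0
  | [_] => 0
  | a :: b :: l => ψ a b + pathWt ψ (b :: l)

/-- Topological transitivity: any two symbols are connected by a path. -/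
def TopTrans (A : ℕ → ℕ → Prop) : Prop :=
  ∀ a b : ℕ, ∃ w : List ℕ, IsPath A w ∧ w.headI = a ∧ w.getLastD 0 = b

/-- The Birkhoff sum `Sₙφ`. -/
def birkhoff (A : ℕ → ℕ → Prop) (φ : MShift A → ℝ) (n : ℕ) (x : MShift A) : ℝ :=
  ∑ i ∈ Finset.range n, φ ((shiftMap A)^[i] x)

/-- The Gurevich partition function `Zₙ(φ, a)`. -/
def Zpart (A : ℕ → ℕ → Prop) (φ : MShift A → ℝ) (n : ℕ) (a : ℕ) : ℝ≥0∞ :=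
  ∑' x : {x : MShift A // (shiftMap A)^[n] x = x ∧ x.seq 0 = a},
    ENNReal.ofReal (Real.exp (birkhoff A φ n x.1))

/-- `Zₙ*(φ, a)`: the partition function restricted to first returns to `a`. -/
def ZpartStar (A : ℕ → ℕ → Prop) (φ : MShift A → ℝ) (n : ℕ) (a : ℕ) : ℝ≥0∞ :=
  ∑' x : {x : MShift A // (shiftMap A)^[n] x = x ∧ x.seq 0 = a ∧
      ∀ k, 0 < k → k < n → x.seq k ≠ a},
    ENNReal.ofReal (Real.exp (birkhoff A φ n x.1))

/-- The Gurevich pressure `P_G(φ) = limsup (1/n) log Zₙ(φ, a)` (at the symbol `a`),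
as an extended real number. -/
def PGur (A : ℕ → ℕ → Prop) (φ : MShift A → ℝ) (a : ℕ) : EReal :=
  Filter.atTop.limsup fun n : ℕ => (((n : ℝ)⁻¹ : ℝ) : EReal) * ENNReal.log (Zpart A φ n a)

/-- `p` is the (common, symbol-independent) value of the Gurevich pressure of `φ`. -/
def IsPG (A : ℕ → ℕ → Prop) (φ : MShift A → ℝ) (p : EReal) : Prop :=
  ∀ a : ℕ, (∃ x : MShift A, x.seq 0 = a) → PGur A φ a = p

/-- `φ` is a summable potential: `Σᵢ exp (sup φ|_[i]) < ∞`. -/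
def SummablePot (A : ℕ → ℕ → Prop) (φ : MShift A → ℝ) : Prop :=
  ∃ s : ℕ → ℝ, Summable (fun i => Real.exp (s i)) ∧
    ∀ (i : ℕ) (x : MShift A), x.seq 0 = i → φ x ≤ s i

/-- `V` is a bound for the `n`-th variation `Varₙ(φ)`. -/
def VarBdd (A : ℕ → ℕ → Prop) (φ : MShift A → ℝ) (n : ℕ) (V : ℝ) : Prop :=
  ∀ x y : MShift A, (∀ i < n, x.seq i = y.seq i) → |φ x - φ y| ≤ V

/-- σ-invariance of a Borel measure on the shift space. -/
def ShiftInv (A : ℕ → ℕ → Prop) (μ : Measure (MShift A)) : Prop :=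
  ∀ s : Set (MShift A), MeasurableSet s → μ (shiftMap A ⁻¹' s) = μ s

/-- The maximal ergodic average `α(φ)`. -/
def alphaSup (A : ℕ → ℕ → Prop) (φ : MShift A → ℝ) : ℝ :=
  sSup {r : ℝ | ∃ μ : Measure (MShift A), IsProbabilityMeasure μ ∧ ShiftInv A μ ∧
    Integrable φ μ ∧ r = ∫ x, φ x ∂μ}

/-- `μ` is the Gurevich–Markov (stationary Markov equilibrium) measure associated to the
Markov potential `ψ` with pressure `p`. -/
structure IsGM (A : ℕ → ℕ → Prop) (ψ : ℕ → ℕ → ℝ) (p : ℝ) (μ : Measure (MShift A)) : Prop where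
  prob : IsProbabilityMeasure μ
  inv : ShiftInv A μ
  eigen : ∃ h hT : ℕ → ℝ, (∀ a, 0 < h a) ∧ (∀ a, 0 < hT a) ∧
    (∀ j : ℕ, (∑' a : {a : ℕ // A a j}, ENNReal.ofReal (Real.exp (ψ a.1 j) * h a.1))
        = ENNReal.ofReal (Real.exp p * h j)) ∧
    (∀ j : ℕ, (∑' b : {b : ℕ // A j b}, ENNReal.ofReal (Real.exp (ψ j b.1) * hT b.1))
        = ENNReal.ofReal (Real.exp p * hT j)) ∧
    (∑' a : ℕ, ENNReal.ofReal (h a * hT a)) = 1 ∧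
    (∀ w : List ℕ, w ≠ [] → w.Chain' A → (cylSet A w).Nonempty →
      μ (cylSet A w) = ENNReal.ofReal
        (h w.headI * hT (w.getLastD 0) * Real.exp (pathWt ψ w - (pathLen w : ℝ) * p)))

/-! ## Loops and main paths (one-sided) -/

/-- A loop at `a`. -/
def IsLoopAt (A : ℕ → ℕ → Prop) (a : ℕ) (w : List ℕ) : Prop :=
  IsPath A w ∧ w.headI = a ∧ w.getLastD 0 = a

/-- The word `w` passes through `b`, i.e. some intermediate symbol of `w` equals `b`. -/
def PassesThrough (w : List ℕ) (b : ℕ) : Prop :=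
  ∃ m, 0 < m ∧ m < w.length - 1 ∧ w.getD m 0 = b

/-- No intermediate symbol of `w` lies in `J`. -/
def AvoidsIn (w : List ℕ) (J : Finset ℕ) : Prop :=
  ∀ m, 0 < m → m < w.length - 1 → w.getD m 0 ∉ J

/-- A first-return loop at `c`: a loop at `c` with no intermediate occurrence of `c`. -/
def FirstRetLoop (A : ℕ → ℕ → Prop) (c : ℕ) (w : List ℕ) : Prop :=
  IsPath A w ∧ w.headI = c ∧ w.getLastD 0 = c ∧
    ∀ m, 0 < m → m < w.length - 1 → w.getD m 0 ≠ c

/-- A main path from `i` to `j` (relative to the pair of symbols `{a, b}`): a path from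
`i` to `j` with no intermediate occurrence of `a` nor of `b`. -/
def MainPath (A : ℕ → ℕ → Prop) (a b i j : ℕ) (w : List ℕ) : Prop :=
  IsPath A w ∧ w.headI = i ∧ w.getLastD 0 = j ∧
    ∀ m, 0 < m → m < w.length - 1 → w.getD m 0 ≠ a ∧ w.getD m 0 ≠ b

/-- `p_{ij}^t`: the sum of `exp(ψ(γ) − l(γ)·p)` over all main paths from `i` to `j`. -/
def pSum (A : ℕ → ℕ → Prop) (ψ : ℕ → ℕ → ℝ) (p : ℝ) (a b i j : ℕ) : ℝ≥0∞ :=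
  ∑' w : {w : List ℕ // MainPath A a b i j w},
    ENNReal.ofReal (Real.exp (pathWt ψ w.1 - (pathLen w.1 : ℝ) * p))

/-- `r_{ij}^t`: as `pSum`, restricted to main paths all of whose symbols lie in `S'`. -/
def rSum (A : ℕ → ℕ → Prop) (ψ : ℕ → ℕ → ℝ) (p : ℝ) (a b i j : ℕ) (S' : Finset ℕ) : ℝ≥0∞ :=
  ∑' w : {w : List ℕ // MainPath A a b i j w ∧ ∀ m < w.length, w.getD m 0 ∈ S'},
    ENNReal.ofReal (Real.exp (pathWt ψ w.1 - (pathLen w.1 : ℝ) * p))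

/-- Number of intermediate occurrences of symbols of `I` in the word `w`. -/
def interCount (I : Finset ℕ) (w : List ℕ) : ℕ :=
  ((w.drop 1).take (w.length - 2)).countP (fun s => decide (s ∈ I))

/-- `p_{ij}^t(n)`: as `pSum`, restricted to main paths with exactly `n` intermediate
occurrences of symbols of `I`. -/
def pSumN (A : ℕ → ℕ → Prop) (ψ : ℕ → ℕ → ℝ) (p : ℝ) (a b i j : ℕ)
    (I : Finset ℕ) (n : ℕ) : ℝ≥0∞ :=
  ∑' w : {w : List ℕ // MainPath A a b i j w ∧ interCount I w = n},
    ENNReal.ofReal (Real.exp (pathWt ψ w.1 - (pathLen w.1 : ℝ) * p))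

/-- An `I`-free path from `i` to `j`: a path from `i` to `j` with no intermediate
symbol in `I`. -/
def IFree (A : ℕ → ℕ → Prop) (I : Finset ℕ) (i j : ℕ) (w : List ℕ) : Prop :=
  IsPath A w ∧ w.headI = i ∧ w.getLastD 0 = j ∧
    ∀ m, 0 < m → m < w.length - 1 → w.getD m 0 ∉ I

/-! ## Two-sided countable Markov shifts -/

/-- The two-sided countable Markov shift determined by `A`. -/
structure MShift2 (A : ℕ → ℕ → Prop) : Type where
  seq : ℤ → ℕ
  adm : ∀ i : ℤ, A (seq i) (seq (i + 1))

instance (A : ℕ → ℕ → Prop) : TopologicalSpace (MShift2 A) :=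
  TopologicalSpace.induced MShift2.seq inferInstance

instance (A : ℕ → ℕ → Prop) : MeasurableSpace (MShift2 A) := borel (MShift2 A)

instance (A : ℕ → ℕ → Prop) : BorelSpace (MShift2 A) := ⟨rfl⟩

/-- The (invertible) shift map on the two-sided shift. -/
def shiftMap2 (A : ℕ → ℕ → Prop) (x : MShift2 A) : MShift2 A :=
  ⟨fun i => x.seq (i + 1), fun i => x.adm (i + 1)⟩

/-- Cylinder based at coordinate 0 in the two-sided shift. -/
def cylSet2 (A : ℕ → ℕ → Prop) (w : List ℕ) : Set (MShift2 A) :=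
  {x | ∀ i < w.length, x.seq (i : ℤ) = w.getD i 0}

/-- A path in the two-sided shift: an admissible word `x₀ … xₙ`, `n ≥ 1`. -/
def IsPath2 (A : ℕ → ℕ → Prop) (w : List ℕ) : Prop :=
  2 ≤ w.length ∧ w.Chain' A

/-- σ-invariance of a Borel measure on the two-sided shift. -/
def ShiftInv2 (A : ℕ → ℕ → Prop) (μ : Measure (MShift2 A)) : Prop :=
  ∀ s : Set (MShift2 A), MeasurableSet s → μ (shiftMap2 A ⁻¹' s) = μ s

/-- Main path from `i` to `j` relative to `{a, b}` in the two-sided shift. -/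
def MainPath2 (A : ℕ → ℕ → Prop) (a b i j : ℕ) (w : List ℕ) : Prop :=
  IsPath2 A w ∧ w.headI = i ∧ w.getLastD 0 = j ∧
    ∀ m, 0 < m → m < w.length - 1 → w.getD m 0 ≠ a ∧ w.getD m 0 ≠ b

/-- `p_{ij}`: the sum of `exp(ψ(γ) − l(γ)·P)` over all main paths from `i` to `j`
in the two-sided shift. -/
def pSum2 (A : ℕ → ℕ → Prop) (ψ : ℕ → ℕ → ℝ) (P : ℝ) (a b i j : ℕ) : ℝ≥0∞ :=
  ∑' w : {w : List ℕ // MainPath2 A a b i j w},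
    ENNReal.ofReal (Real.exp (pathWt ψ w.1 - (pathLen w.1 : ℝ) * P))

/-! ## The Ruelle operator and the renewal shift -/

/-- The Ruelle (transfer) operator acting on nonnegative measurable functions. -/
def ruelleOp (A : ℕ → ℕ → Prop) (ψ : MShift A → ℝ) (f : MShift A → ℝ≥0∞)
    (x : MShift A) : ℝ≥0∞ :=
  ∑' y : {y : MShift A // shiftMap A y = x}, ENNReal.ofReal (Real.exp (ψ y.1)) * f y.1

/-- The transition matrix of the renewal shift: `A(1,1) = A(1,i) = A(i, i-1) = 1` for
every `i > 1`, all other entries `0` (alphabet `{1, 2, …}`). -/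
def renewalA : ℕ → ℕ → Prop := fun i j => (i = 1 ∧ 1 ≤ j) ∨ (2 ≤ i ∧ j = i - 1)

/-- The potential `φ(x) = -x₀` on the renewal shift. -/
def phiRen : MShift renewalA → ℝ := fun x => -(x.seq 0 : ℝ)

/-- The potential `φ(x) = x₀ - x₁` on the renewal shift. -/
def phiRen2 : MShift renewalA → ℝ := fun x => (x.seq 0 : ℝ) - (x.seq 1 : ℝ)

/-- The fixed point `1̄ = (1,1,1,…)` of the renewal shift. -/
def onebar : MShift renewalA := ⟨fun _ => 1, fun _ => Or.inl ⟨rfl, le_refl 1⟩⟩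

end

theorem MShift.ext_seq {A : ℕ → ℕ → Prop} {x y : MShift A} (h : ∀ n, x.seq n = y.seq n) :
    x = y := by
  cases x
  cases y
  congr
  exact funext h

theorem MShift.continuous_seq (A : ℕ → ℕ → Prop) : Continuous (MShift.seq : MShift A → ℕ → ℕ) :=
  continuous_induced_dom

theorem one_le_seq_of_renewalA (x : MShift renewalA) (n : ℕ) : 1 ≤ x.seq n := by
  rcases x.adm n with h | h <;> omega

/-- An invariant measure gives the event `x n = a` the same mass as the cylinder `[a]`. -/
theorem ShiftInv.measure_seq_eq {A : ℕ → ℕ → Prop} {μ : Measure (MShift A)}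
    (hinv : ShiftInv A μ) (a n : ℕ) : μ {x | x.seq n = a} = μ (cylSet A [a]) := by
  induction n with
  | zero => congr 1; ext x; simp [cylSet]
  | succ n ih =>
    rw [← ih]
    exact hinv {x | x.seq n = a} <| ((isOpen_discrete {a}).preimage
      ((continuous_apply n).comp (MShift.continuous_seq A))).measurableSet

/-- A σ-invariant Borel probability measure on the renewal shift
giving zero mass to `[a]` for every `a ≥ 2` is the Dirac measure at `1̄ = (1,1,1,…)`. -/
theorem stmt18 (μ : Measure (MShift renewalA)) (hprob : IsProbabilityMeasure μ)
    (hinv : ShiftInv renewalA μ)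
    (hzero : ∀ a : ℕ, 2 ≤ a → μ (cylSet renewalA [a]) = 0) :
    μ = Measure.dirac onebar ∧
    ∀ w : List ℕ, μ (cylSet renewalA w) = Measure.dirac onebar (cylSet renewalA w) := by
  have hae : ∀ᵐ x ∂μ, x = onebar := by
    have h : ∀ n a : ℕ, 2 ≤ a → ∀ᵐ x ∂μ, x.seq n ≠ a := fun n a ha => by
      simpa [ae_iff] using (hinv.measure_seq_eq a n).trans (hzero a ha)
    have h' : ∀ᵐ x ∂μ, ∀ n a : ℕ, 2 ≤ a → x.seq n ≠ a := by
      simpa only [ae_all_iff] using h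
    filter_upwards [h'] with x hx
    refine MShift.ext_seq fun n => ?_
    have h1 := one_le_seq_of_renewalA x n
    by_contra hne
    change x.seq n ≠ 1 at hne
    exact hx n (x.seq n) (by omega) rfl
  have hμ : μ = Measure.dirac onebar := by
    calc μ = μ.map id := Measure.map_id.symm
      _ = μ.map (fun _ => onebar) := Measure.map_congr hae
      _ = Measure.dirac onebar := by simp [Measure.map_const]
  exact ⟨hμ, fun w => by rw [hμ]⟩
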